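/- For every 0 < p ≤ 2, ∫_0^∞ 𝔧₁(t)² t^{p-1} dt ≤ 2^{p-1} Γ(p/2). Equivalently, for a random vector ξ uniform on the unit Euclidean sphere S^3 in ℝ^4, E|e_1 + ξ|^{-p} ≤ Γ(2 - p/2). -/

import Mathlib

open MeasureTheory Real Set
open scoped ENNReal

/-- `μ` is the uniform probability measure on the unit sphere `S^{d-1}` in `ℝ^d`:
it is supported on the unit sphere and invariant under every orthogonal map. -/
def IsUniformOnSphere {d : ℕ} (μ : Measure (EuclideanSpace ℝ (Fin d))) : Prop :=
  μ (Metric.sphere (0 : EuclideanSpace ℝ (Fin d)) 1)ᶜ = 0 ∧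
  ∀ Q : EuclideanSpace ℝ (Fin d) ≃ₗᵢ[ℝ] EuclideanSpace ℝ (Fin d), μ.map ⇑Q = μ

/-- `𝔧₁(t) = ∑_{k=0}^∞ (-1)^k / (k! (k+1)!) (t/2)^{2k} = 2J₁(t)/t`. -/
noncomputable def jj1 (t : ℝ) : ℝ :=
  ∑' k : ℕ, ((-1 : ℝ) ^ k / ((k.factorial : ℝ) * ((k + 1).factorial : ℝ))) * (t / 2) ^ (2 * k)

/-! ### The first coordinate of a uniform point on the three-sphere -/

lemma IsUniformOnSphere.ae_norm_eq_one {d : ℕ} {μ : Measure (EuclideanSpace ℝ (Fin d))}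
    (hμ : IsUniformOnSphere μ) : ∀ᵐ x ∂μ, ‖x‖ = 1 := by
  have h : ∀ᵐ x ∂μ, x ∈ Metric.sphere (0 : EuclideanSpace ℝ (Fin d)) 1 := hμ.1
  filter_upwards [h] with x hx
  simpa using hx

/-- Integrals against a uniform measure on the sphere are invariant under the reflection that acts
on the first and the `j`-th coordinate with angle `θ`. -/
lemma IsUniformOnSphere.integral_comp_rotate {μ : Measure (EuclideanSpace ℝ (Fin 4))}
    (hμ : IsUniformOnSphere μ) {j : Fin 4} (hj : j ≠ 0) (g : ℝ → ℝ → ℝ) (θ : ℝ) :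
    ∫ x, g (x 0 * cos θ + x j * sin θ) (x 0 * sin θ - x j * cos θ) ∂μ
      = ∫ x, g (x 0) (x j) ∂μ := by
  set v : EuclideanSpace ℝ (Fin 4) :=
    cos (θ / 2) • EuclideanSpace.single 0 1 + sin (θ / 2) • EuclideanSpace.single j 1 with hv
  set Q := (Submodule.span ℝ {v}).reflection
  have hv0 : v 0 = cos (θ / 2) := by simp [hv, hj.symm]
  have hvj : v j = sin (θ / 2) := by simp [hv, hj]
  have hinner : ∀ x : EuclideanSpace ℝ (Fin 4),
      inner ℝ v x = cos (θ / 2) * x 0 + sin (θ / 2) * x j := by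
    intro x
    simp [hv, inner_add_left, inner_smul_left, EuclideanSpace.inner_single_left]
  have hnorm : ‖v‖ ^ 2 = 1 := by
    rw [← real_inner_self_eq_norm_sq, hinner, hv0, hvj]
    nlinarith [sin_sq_add_cos_sq (θ / 2)]
  have hQ : ∀ x, Q x = 2 • (inner ℝ v x) • v - x := by
    intro x
    simp [Q, Submodule.reflection_singleton_apply, hnorm]
  have hc : cos θ = 2 * cos (θ / 2) ^ 2 - 1 := by rw [← cos_two_mul]; ring_nf
  have hs : sin θ = 2 * sin (θ / 2) * cos (θ / 2) := by rw [← sin_two_mul]; ring_nf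
  have h0 : ∀ x, Q x 0 = x 0 * cos θ + x j * sin θ := by
    intro x
    rw [hQ, hc, hs]
    simp only [PiLp.sub_apply, PiLp.smul_apply, hinner, hv0, smul_eq_mul, nsmul_eq_mul]
    push_cast; ring
  have h1 : ∀ x, Q x j = x 0 * sin θ - x j * cos θ := by
    intro x
    rw [hQ, hc, hs]
    simp only [PiLp.sub_apply, PiLp.smul_apply, hinner, hvj, smul_eq_mul, nsmul_eq_mul]
    push_cast
    linear_combination 2 * x j * sin_sq_add_cos_sq (θ / 2)
  have hmap := (Q.toHomeomorph.measurableEmbedding).integral_map (μ := μ)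
    (fun x => g (x 0) (x j))
  rw [show ⇑Q.toHomeomorph = ⇑Q from rfl, hμ.2 Q] at hmap
  rw [hmap]
  exact integral_congr_ae (ae_of_all _ fun x => by
    change g _ _ = g (Q x 0) (Q x j); rw [h0, h1])

lemma EuclideanSpace.sq_apply_le_norm_sq {d : ℕ} (x : EuclideanSpace ℝ (Fin d)) (i : Fin d) :
    x i ^ 2 ≤ ‖x‖ ^ 2 := by
  rw [EuclideanSpace.real_norm_sq_eq]
  exact Finset.single_le_sum (f := fun i => x i ^ 2) (fun i _ => sq_nonneg _) (Finset.mem_univ i)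

lemma IsUniformOnSphere.integral_deriv_mul_sq {μ : Measure (EuclideanSpace ℝ (Fin 4))}
    [IsProbabilityMeasure μ] (hμ : IsUniformOnSphere μ) {j : Fin 4} (hj : j ≠ 0) {F F' : ℝ → ℝ}
    (hFm : Measurable F) (hFm' : Measurable F')
    (hF : ∀ u ∈ Icc (-1 : ℝ) 1, HasDerivAt F (F' u) u) (hF' : ContinuousOn F' (Icc (-1) 1)) :
    Integrable (fun x => F' (x 0) * x j ^ 2 - F (x 0) * x 0) μ ∧
      ∫ x, (F' (x 0) * x j ^ 2 - F (x 0) * x 0) ∂μ = 0 := by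
  obtain ⟨C, hC⟩ := isCompact_Icc.exists_bound_of_continuousOn hF'
  obtain ⟨B, hB⟩ := isCompact_Icc.exists_bound_of_continuousOn
    (fun u hu => (hF u hu).continuousAt.continuousWithinAt)
  have hab : ∀ a b θ : ℝ, a ^ 2 + b ^ 2 ≤ 1 → a * cos θ + b * sin θ ∈ Icc (-1 : ℝ) 1 ∧
      |a * sin θ - b * cos θ| ≤ 1 ∧ |a * cos θ + b * sin θ| ≤ 1 := by
    intro a b θ h
    have h1 : (a * cos θ + b * sin θ) ^ 2 + (a * sin θ - b * cos θ) ^ 2 ≤ 1 := by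
      have : (a * cos θ + b * sin θ) ^ 2 + (a * sin θ - b * cos θ) ^ 2 = a ^ 2 + b ^ 2 := by
        linear_combination (a ^ 2 + b ^ 2) * sin_sq_add_cos_sq θ
      linarith
    have h2 : |a * cos θ + b * sin θ| ≤ 1 := by
      rw [← sq_le_one_iff_abs_le_one]; nlinarith [sq_nonneg (a * sin θ - b * cos θ)]
    have h3 : |a * sin θ - b * cos θ| ≤ 1 := by
      rw [← sq_le_one_iff_abs_le_one]; nlinarith [sq_nonneg (a * cos θ + b * sin θ)]
    exact ⟨abs_le.mp h2, h3, h2⟩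
  have hsph : ∀ᵐ x ∂μ, x 0 ^ 2 + x j ^ 2 ≤ 1 := by
    filter_upwards [hμ.ae_norm_eq_one] with x hx
    have := EuclideanSpace.real_norm_sq_eq x
    rw [hx, one_pow, ← Finset.add_sum_erase _ _ (Finset.mem_univ 0)] at this
    have h2 : x j ^ 2 ≤ ∑ i ∈ Finset.univ.erase (0 : Fin 4), x i ^ 2 :=
      Finset.single_le_sum (f := fun i => x i ^ 2) (fun i _ => sq_nonneg _) (by simp [hj])
    linarith
  set D : ℝ → EuclideanSpace ℝ (Fin 4) → ℝ := fun θ x =>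
    F' (x 0 * cos θ + x j * sin θ) * (x j * cos θ - x 0 * sin θ) * (x 0 * sin θ - x j * cos θ)
      + F (x 0 * cos θ + x j * sin θ) * (x 0 * cos θ + x j * sin θ)
  have key := hasDerivAt_integral_of_dominated_loc_of_deriv_le (μ := μ) (x₀ := (0 : ℝ))
    (s := Set.univ) (bound := fun _ => C + B)
    (F := fun θ x => F (x 0 * cos θ + x j * sin θ) * (x 0 * sin θ - x j * cos θ)) (F' := D)
    Filter.univ_mem
    (Filter.Eventually.of_forall fun θ => by
      exact ((hFm.comp (by fun_prop)).mul (by fun_prop)).aestronglyMeasurable)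
    (by
      refine Integrable.of_bound (C := B)
        ((hFm.comp (by fun_prop)).mul (by fun_prop)).aestronglyMeasurable ?_
      filter_upwards [hsph] with x hx
      obtain ⟨h1, h2, h3⟩ := hab _ _ 0 hx
      rw [norm_mul]
      have := hB _ h1
      calc _ ≤ B * 1 := mul_le_mul this h2 (abs_nonneg _) ((norm_nonneg _).trans this)
        _ = B := mul_one B)
    (by
      refine Measurable.aestronglyMeasurable ?_
      exact ((((hFm'.comp (by fun_prop)).mul (by fun_prop)).mul (by fun_prop)).add
        ((hFm.comp (by fun_prop)).mul (by fun_prop))))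
    (by
      filter_upwards [hsph] with x hx θ _
      obtain ⟨h1, h2, h3⟩ := hab _ _ θ hx
      have hb := hB _ h1
      have hc := hC _ h1
      have h2' : |x j * cos θ - x 0 * sin θ| ≤ 1 := by rw [abs_sub_comm]; exact h2
      refine (norm_add_le _ _).trans (add_le_add ?_ ?_)
      · rw [norm_mul, norm_mul]
        calc _ ≤ C * 1 * 1 := by
              have hC0 := (norm_nonneg _).trans hc
              gcongr <;> assumption
          _ = C := by ring
      · rw [norm_mul]
        calc _ ≤ B * 1 := mul_le_mul hb h3 (abs_nonneg _) ((norm_nonneg _).trans hb)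
          _ = B := mul_one B)
    (integrable_const _)
    (by
      filter_upwards [hsph] with x hx θ _
      obtain ⟨h1, -, -⟩ := hab _ _ θ hx
      have e1 : HasDerivAt (fun θ => x 0 * cos θ + x j * sin θ) (x j * cos θ - x 0 * sin θ) θ := by
        exact (((hasDerivAt_cos θ).const_mul (x 0)).add
          ((hasDerivAt_sin θ).const_mul (x j))).congr_deriv (by ring)
      have e2 : HasDerivAt (fun θ => x 0 * sin θ - x j * cos θ) (x 0 * cos θ + x j * sin θ) θ := by
        exact (((hasDerivAt_sin θ).const_mul (x 0)).sub
          ((hasDerivAt_cos θ).const_mul (x j))).congr_deriv (by ring)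
      exact ((hF _ h1).comp θ e1).mul e2)
  have hconst : (fun θ : ℝ => ∫ x, F (x 0 * cos θ + x j * sin θ) * (x 0 * sin θ - x j * cos θ) ∂μ)
      = fun _ => ∫ x, F (x 0) * x j ∂μ :=
    funext fun θ => hμ.integral_comp_rotate hj (fun a b => F a * b) θ
  have hD : D 0 = fun x => -(F' (x 0) * x j ^ 2 - F (x 0) * x 0) := by
    funext x; simp only [D, cos_zero, sin_zero]; simp only [mul_one, mul_zero, add_zero]; ring
  rw [hD, hconst] at key
  refine ⟨by simpa only [Pi.neg_apply, neg_neg] using key.1.fun_neg, ?_⟩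
  have := key.2.unique (hasDerivAt_const _ _)
  rwa [integral_neg, neg_eq_zero] at this

/-- The Stein identity for the first coordinate of a uniform point on the three-sphere. -/
lemma IsUniformOnSphere.integral_stein {μ : Measure (EuclideanSpace ℝ (Fin 4))}
    [IsProbabilityMeasure μ] (hμ : IsUniformOnSphere μ) {F F' : ℝ → ℝ}
    (hFm : Measurable F) (hFm' : Measurable F')
    (hF : ∀ u ∈ Icc (-1 : ℝ) 1, HasDerivAt F (F' u) u) (hF' : ContinuousOn F' (Icc (-1) 1)) :
    ∫ x, (F' (x 0) * (1 - x 0 ^ 2) - 3 * (F (x 0) * x 0)) ∂μ = 0 := by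
  have h := fun (j : Fin 4) (hj : j ≠ 0) => hμ.integral_deriv_mul_sq hj hFm hFm' hF hF'
  obtain ⟨i1, e1⟩ := h 1 (by decide)
  obtain ⟨i2, e2⟩ := h 2 (by decide)
  obtain ⟨i3, e3⟩ := h 3 (by decide)
  have : ∫ x, ((F' (x 0) * x 1 ^ 2 - F (x 0) * x 0) + (F' (x 0) * x 2 ^ 2 - F (x 0) * x 0)
      + (F' (x 0) * x 3 ^ 2 - F (x 0) * x 0)) ∂μ = 0 := by
    rw [integral_add (by exact i1.add i2) i3, integral_add i1 i2, e1, e2, e3]; simp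
  rw [← this]
  refine integral_congr_ae ?_
  filter_upwards [hμ.ae_norm_eq_one] with x hx
  have := EuclideanSpace.real_norm_sq_eq x
  rw [hx, one_pow, Fin.sum_univ_four] at this
  rw [this]; ring

lemma IsUniformOnSphere.ae_apply_mem_Icc {d : ℕ} {μ : Measure (EuclideanSpace ℝ (Fin d))}
    (hμ : IsUniformOnSphere μ) (i : Fin d) : ∀ᵐ x ∂μ, x i ∈ Icc (-1 : ℝ) 1 := by
  filter_upwards [hμ.ae_norm_eq_one] with x hx
  have := EuclideanSpace.sq_apply_le_norm_sq x i
  rw [hx, one_pow, sq_le_one_iff_abs_le_one] at this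
  exact abs_le.mp this

lemma IsUniformOnSphere.integrable_comp_apply {d : ℕ} {μ : Measure (EuclideanSpace ℝ (Fin d))}
    [IsProbabilityMeasure μ] (hμ : IsUniformOnSphere μ) (i : Fin d) {F : ℝ → ℝ}
    (hFm : Measurable F) (hF : ContinuousOn F (Icc (-1) 1)) : Integrable (fun x => F (x i)) μ := by
  obtain ⟨C, hC⟩ := isCompact_Icc.exists_bound_of_continuousOn hF
  refine Integrable.of_bound (C := C) (hFm.comp (by fun_prop)).aestronglyMeasurable ?_
  filter_upwards [hμ.ae_apply_mem_Icc i] with x hx using hC _ hx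

lemma IsUniformOnSphere.integral_two_add_pow {μ : Measure (EuclideanSpace ℝ (Fin 4))}
    [IsProbabilityMeasure μ] (hμ : IsUniformOnSphere μ) (k : ℕ) :
    ∫ x, (2 + 2 * x 0) ^ k ∂μ = ((k + 1).centralBinom : ℝ) / (k + 2) := by
  have hInt : ∀ k : ℕ, Integrable (fun x : EuclideanSpace ℝ (Fin 4) => (2 + 2 * x 0) ^ k) μ :=
    fun k => hμ.integrable_comp_apply 0 (F := fun u => (2 + 2 * u) ^ k) (by fun_prop) (by fun_prop)
  induction k with
  | zero => simp [Nat.centralBinom]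
  | succ k ih =>
    have h := hμ.integral_stein (F := fun u => (2 + 2 * u) ^ k)
      (F' := fun u => k * (2 + 2 * u) ^ (k - 1) * 2) (by fun_prop) (by fun_prop)
      (fun u _ => by
        exact ((((hasDerivAt_id u).const_mul 2).const_add 2).pow k).congr_deriv (by simp))
      (by fun_prop)
    have e : ∀ x : EuclideanSpace ℝ (Fin 4),
        k * (2 + 2 * x 0) ^ (k - 1) * 2 * (1 - x 0 ^ 2) - 3 * ((2 + 2 * x 0) ^ k * x 0)
          = (2 * k + 3) * (2 + 2 * x 0) ^ k - (k + 3) / 2 * (2 + 2 * x 0) ^ (k + 1) := by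
      intro x
      have : (k : ℝ) * (2 + 2 * x 0) ^ (k - 1) * (2 + 2 * x 0) = k * (2 + 2 * x 0) ^ k := by
        cases k with
        | zero => simp
        | succ n => simp [pow_succ]; ring
      rw [pow_succ]
      linear_combination (1 - x 0) * this
    simp_rw [e] at h
    rw [integral_sub ((hInt k).const_mul _) ((hInt (k + 1)).const_mul _), integral_const_mul,
      integral_const_mul, ih] at h
    have hc : ((k + 2 : ℕ) : ℝ) * (k + 1 + 1).centralBinom
        = 2 * (2 * (k + 1) + 1) * (k + 1).centralBinom := by
      exact_mod_cast Nat.succ_mul_centralBinom_succ (k + 1)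
    push_cast at hc ⊢
    have h2 : (k : ℝ) + 2 ≠ 0 := by positivity
    have h3 : (k : ℝ) + 1 + 2 ≠ 0 := by positivity
    generalize ∫ x : EuclideanSpace ℝ (Fin 4), (2 + 2 * x 0) ^ (k + 1) ∂μ = I at h ⊢
    field_simp at h ⊢
    have : ((k : ℝ) + 2) * (I * (k + 1 + 2) - (k + 1 + 1).centralBinom) = 0 := by
      linear_combination -h - hc
    have := (mul_eq_zero.mp this).resolve_left h2
    linarith

/-- The mean value property of the Newton kernel on the three-sphere. -/
lemma IsUniformOnSphere.integral_inv_one_add_sq {μ : Measure (EuclideanSpace ℝ (Fin 4))}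
    [IsProbabilityMeasure μ] (hμ : IsUniformOnSphere μ) {r : ℝ} (hr0 : 0 < r) (hr1 : r < 1) :
    ∫ x, (1 + r ^ 2 + 2 * r * x 0)⁻¹ ∂μ = 1 := by
  have hD : ∀ ρ < (1 : ℝ), ∀ r ∈ Ioo (-ρ) ρ, ∀ u ∈ Icc (-1 : ℝ) 1,
      (1 - ρ) ^ 2 ≤ 1 + r ^ 2 + 2 * r * u := by
    intro ρ hρ r hr u hu
    have h1 : |r| < ρ := abs_lt.mpr hr
    have h2 : |r * u| ≤ |r| := by
      rw [abs_mul]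
      exact mul_le_of_le_one_right (abs_nonneg _) (abs_le.mpr hu)
    have h3 := neg_abs_le (r * u)
    nlinarith [sq_abs r, abs_nonneg r]
  have hpos : ∀ r ∈ Ioo (-1 : ℝ) 1, ∀ u ∈ Icc (-1 : ℝ) 1, 0 < 1 + r ^ 2 + 2 * r * u := by
    intro r hr u hu
    have h1 : |r| < 1 := abs_lt.mpr hr
    have := hD ((1 + |r|) / 2) (by linarith) r (abs_lt.mp (by linarith)) u hu
    have h2 : 0 < 1 - (1 + |r|) / 2 := by linarith
    have := pow_pos h2 2
    linarith
  have hcont : ∀ r ∈ Ioo (-1 : ℝ) 1,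
      ContinuousOn (fun u => (1 + r ^ 2 + 2 * r * u)⁻¹) (Icc (-1 : ℝ) 1) := fun r hr =>
    ContinuousOn.inv₀ (by fun_prop) fun u hu => (hpos r hr u hu).ne'
  set G : ℝ → ℝ := fun r => ∫ x, (1 + r ^ 2 + 2 * r * x 0)⁻¹ ∂μ with hG
  have hInt : ∀ r ∈ Ioo (-1 : ℝ) 1, Integrable (fun x => (1 + r ^ 2 + 2 * r * x 0)⁻¹) μ :=
    fun r hr => hμ.integrable_comp_apply 0 (F := fun u => (1 + r ^ 2 + 2 * r * u)⁻¹)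
      (by fun_prop) (hcont r hr)
  have hderiv : ∀ r ∈ Ioo (-1 : ℝ) 1,
      HasDerivAt G (∫ x, -(2 * r + 2 * x 0) / (1 + r ^ 2 + 2 * r * x 0) ^ 2 ∂μ) r := by
    intro r hr
    have h1 : |r| < 1 := abs_lt.mpr hr
    set ρ := (1 + |r|) / 2
    have hρ : ρ < 1 := by simp only [ρ]; linarith
    have hrρ : r ∈ Ioo (-ρ) ρ := abs_lt.mp (by simp only [ρ]; linarith)
    have hsub : ∀ s ∈ Ioo (-ρ) ρ, s ∈ Ioo (-1 : ℝ) 1 := fun s hs =>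
      ⟨by linarith [hs.1], by linarith [hs.2]⟩
    have hρ2 : 0 < (1 - ρ) ^ 2 := by have : 0 < 1 - ρ := by linarith
                                     positivity
    refine (hasDerivAt_integral_of_dominated_loc_of_deriv_le (s := Ioo (-ρ) ρ)
      (bound := fun _ => 4 / ((1 - ρ) ^ 2) ^ 2)
      (F' := fun r (x : EuclideanSpace ℝ (Fin 4)) =>
        -(2 * r + 2 * x 0) / (1 + r ^ 2 + 2 * r * x 0) ^ 2)
      (Ioo_mem_nhds hrρ.1 hrρ.2) ?_ (hInt r hr) ?_ ?_ (integrable_const _) ?_).2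
    · exact Filter.Eventually.of_forall fun s => Measurable.aestronglyMeasurable (by fun_prop)
    · exact Measurable.aestronglyMeasurable (by fun_prop)
    · filter_upwards [hμ.ae_apply_mem_Icc 0] with x hx s hs
      have h2 := hD ρ hρ s hs _ hx
      have h3 : 0 < 1 + s ^ 2 + 2 * s * x 0 := hpos s (hsub s hs) _ hx
      rw [norm_div, norm_pow, norm_neg, Real.norm_of_nonneg h3.le]
      have h4 : ‖2 * s + 2 * x 0‖ ≤ 4 := by
        have := hsub s hs
        rw [Real.norm_eq_abs, abs_le]
        constructor <;> linarith [this.1, this.2, hx.1, hx.2]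
      gcongr
    · filter_upwards [hμ.ae_apply_mem_Icc 0] with x hx s hs
      have h3 := hpos s (hsub s hs) _ hx
      have : HasDerivAt (fun s : ℝ => 1 + s ^ 2 + 2 * s * x 0) (2 * s + 2 * x 0) s := by
        exact (((hasDerivAt_pow 2 s).const_add 1).add
          (((hasDerivAt_id s).const_mul 2).mul_const (x 0))).congr_deriv (by simp)
      exact this.inv h3.ne'
  have hode : ∀ r ∈ Ioo (-1 : ℝ) 1,
      r * (1 - r ^ 2) * (∫ x, -(2 * r + 2 * x 0) / (1 + r ^ 2 + 2 * r * x 0) ^ 2 ∂μ)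
        = 2 * (1 - G r) := by
    intro r hr
    have h := hμ.integral_stein (F := fun u => (1 + r ^ 2 + 2 * r * u)⁻¹)
      (F' := fun u => -(2 * r) / (1 + r ^ 2 + 2 * r * u) ^ 2) (by fun_prop) (by fun_prop)
      (fun u hu => by
        have : HasDerivAt (fun u : ℝ => 1 + r ^ 2 + 2 * r * u) (2 * r) u := by
          simpa using ((hasDerivAt_id u).const_mul (2 * r)).const_add (1 + r ^ 2)
        exact this.inv (hpos r hr u hu).ne')
      (ContinuousOn.div (by fun_prop) (by fun_prop) fun u hu => (pow_pos (hpos r hr u hu) 2).ne')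
    have hInt' : Integrable
        (fun x : EuclideanSpace ℝ (Fin 4) =>
          -(2 * r + 2 * x 0) / (1 + r ^ 2 + 2 * r * x 0) ^ 2) μ :=
      hμ.integrable_comp_apply 0 (F := fun u => -(2 * r + 2 * u) / (1 + r ^ 2 + 2 * r * u) ^ 2)
        (by fun_prop) (ContinuousOn.div (by fun_prop) (by fun_prop)
          fun u hu => (pow_pos (hpos r hr u hu) 2).ne')
    have e : ∫ x, (r * (1 - r ^ 2) * (-(2 * r + 2 * x 0) / (1 + r ^ 2 + 2 * r * x 0) ^ 2)
        - 2 * (1 - (1 + r ^ 2 + 2 * r * x 0)⁻¹)) ∂μ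
        = ∫ x, 2 * r * (-(2 * r) / (1 + r ^ 2 + 2 * r * x 0) ^ 2 * (1 - x 0 ^ 2)
          - 3 * ((1 + r ^ 2 + 2 * r * x 0)⁻¹ * x 0)) ∂μ := by
      refine integral_congr_ae ?_
      filter_upwards [hμ.ae_apply_mem_Icc 0] with x hx
      have hne := (hpos r hr _ hx).ne'
      generalize hD' : 1 + r ^ 2 + 2 * r * x 0 = D at hne ⊢
      field_simp
      rw [← hD']
      ring
    rw [integral_const_mul, h, mul_zero, integral_sub (hInt'.const_mul _)
      (by exact ((integrable_const _).sub (hInt r hr)).const_mul _), integral_const_mul,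
      integral_const_mul,
      integral_sub (integrable_const _) (hInt r hr)] at e
    simp only [integral_const, probReal_univ, smul_eq_mul, one_mul] at e
    linarith
  set Φ : ℝ → ℝ := fun r => (1 - G r) * (r ^ 2 / (1 - r ^ 2))
  have hΦ : ∀ r ∈ Ioo (-1 : ℝ) 1, HasDerivAt Φ 0 r := by
    intro r hr
    have h1 : 1 - r ^ 2 ≠ 0 := by nlinarith [hr.1, hr.2]
    have h2 : HasDerivAt (fun r : ℝ => r ^ 2 / (1 - r ^ 2)) (2 * r / (1 - r ^ 2) ^ 2) r := by
      refine ((hasDerivAt_pow 2 r).div ((hasDerivAt_pow 2 r).const_sub 1) h1).congr_deriv ?_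
      congr 1; simp; ring
    refine (((hderiv r hr).const_sub 1).mul h2).congr_deriv ?_
    have h3 := hode r hr
    generalize ∫ x : EuclideanSpace ℝ (Fin 4),
      -(2 * r + 2 * x 0) / (1 + r ^ 2 + 2 * r * x 0) ^ 2 ∂μ = I at h3 ⊢
    field_simp
    linear_combination -r * h3
  have hmem : r ∈ Ioo (-1 : ℝ) 1 := ⟨by linarith, hr1⟩
  have hconst : Φ r = Φ 0 := isOpen_Ioo.is_const_of_deriv_eq_zero isPreconnected_Ioo
    (fun s hs => (hΦ s hs).differentiableAt.differentiableWithinAt)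
    (fun s hs => (hΦ s hs).deriv) hmem (by simp)
  have h0 : Φ 0 = 0 := by simp [Φ]
  rw [h0] at hconst
  have h1 : r ^ 2 / (1 - r ^ 2) ≠ 0 := by
    have : 0 < 1 - r ^ 2 := by nlinarith
    positivity
  have := (mul_eq_zero.mp hconst).resolve_right h1
  linarith

lemma IsUniformOnSphere.lintegral_inv_two_add_le {μ : Measure (EuclideanSpace ℝ (Fin 4))}
    [IsProbabilityMeasure μ] (hμ : IsUniformOnSphere μ) :
    ∫⁻ x, (ENNReal.ofReal (2 + 2 * x 0))⁻¹ ∂μ ≤ 1 := by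
  set r : ℕ → ℝ := fun n => 1 - 1 / ((n : ℝ) + 2) with hr
  have hr01 : ∀ n, 0 < r n ∧ r n < 1 := by
    intro n
    have h1 : 0 < 1 / ((n : ℝ) + 2) := by positivity
    have h2 : 1 / ((n : ℝ) + 2) < 1 := by
      rw [div_lt_one (by positivity)]; linarith [n.cast_nonneg (α := ℝ)]
    exact ⟨by simp only [hr]; linarith, by simp only [hr]; linarith⟩
  have hlim : Filter.Tendsto r Filter.atTop (nhds 1) := by
    have h : Filter.Tendsto (fun n : ℕ => (n : ℝ) + 2) Filter.atTop Filter.atTop :=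
      Filter.tendsto_atTop_add_const_right _ _ tendsto_natCast_atTop_atTop
    simpa [hr] using (h.inv_tendsto_atTop).const_sub 1
  have hInt : ∀ n, ∫⁻ x, (ENNReal.ofReal (1 + r n ^ 2 + 2 * r n * x 0))⁻¹ ∂μ = 1 := by
    intro n
    obtain ⟨h0, h1⟩ := hr01 n
    have hpos : ∀ᵐ x ∂μ, 0 < 1 + r n ^ 2 + 2 * r n * x 0 := by
      filter_upwards [hμ.ae_apply_mem_Icc 0] with x hx
      nlinarith [hx.1, pow_pos (sub_pos.mpr h1) 2]
    have hi := hμ.integral_inv_one_add_sq h0 h1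
    have hInt : Integrable (fun x : EuclideanSpace ℝ (Fin 4) =>
        (1 + r n ^ 2 + 2 * r n * x 0)⁻¹) μ := by
      by_contra hcon
      rw [integral_undef hcon] at hi
      exact zero_ne_one hi
    have h := ofReal_integral_eq_lintegral_ofReal hInt
      (by filter_upwards [hpos] with x hx using (inv_pos.mpr hx).le)
    rw [hi, ENNReal.ofReal_one] at h
    rw [h]
    refine lintegral_congr_ae ?_
    filter_upwards [hpos] with x hx using (ENNReal.ofReal_inv_of_pos hx).symm
  have hfatou := lintegral_liminf_le (μ := μ) (u := Filter.atTop)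
    (f := fun n (x : EuclideanSpace ℝ (Fin 4)) =>
      (ENNReal.ofReal (1 + r n ^ 2 + 2 * r n * x 0))⁻¹)
    (fun n => by fun_prop)
  simp_rw [hInt, Filter.liminf_const] at hfatou
  refine le_trans (le_of_eq (lintegral_congr fun x => ?_)) hfatou
  have : Filter.Tendsto (fun n => (ENNReal.ofReal (1 + r n ^ 2 + 2 * r n * x 0))⁻¹) Filter.atTop
      (nhds (ENNReal.ofReal (2 + 2 * x 0))⁻¹) := by
    refine tendsto_inv_iff.mpr (ENNReal.tendsto_ofReal ?_)
    have := (((hlim.pow 2).const_add 1).add ((hlim.const_mul 2).mul_const (x 0)))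
    convert this using 2; ring
  exact this.liminf_eq.symm

lemma IsUniformOnSphere.ae_two_add_pos {μ : Measure (EuclideanSpace ℝ (Fin 4))}
    [IsProbabilityMeasure μ] (hμ : IsUniformOnSphere μ) : ∀ᵐ x ∂μ, 0 < 2 + 2 * x 0 := by
  have := ae_lt_top (μ := μ) (f := fun x => (ENNReal.ofReal (2 + 2 * x 0))⁻¹) (by fun_prop)
    (hμ.lintegral_inv_two_add_le.trans_lt ENNReal.one_lt_top).ne
  filter_upwards [this] with x hx
  rw [ENNReal.inv_lt_top] at hx
  exact ENNReal.ofReal_pos.mp hx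

/-- A lower bound for the Stieltjes transform of the exponential distribution. -/
lemma sq_le_integral_mul_exp_neg_div {r : ℝ} (hr0 : 0 < r) (hr1 : r < 1) :
    IntegrableOn (fun y => y * exp (-y) / (1 + r / (1 - r) ^ 2 * y)) (Ioi 0) ∧
    (1 - r) ^ 2 ≤ ∫ y in Ioi (0 : ℝ), y * exp (-y) / (1 + r / (1 - r) ^ 2 * y) := by
  have hc : 0 < 1 - r := by linarith
  set t := r / (1 - r) ^ 2 with ht
  have htpos : 0 < t := by positivity
  have hpos : ∀ y : ℝ, 0 ≤ y → 0 < 1 + t * y := fun y hy => by positivity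
  have hexp : IntegrableOn (fun y => exp (-y)) (Ioi (0 : ℝ)) := integrableOn_exp_neg_Ioi 0
  have hdom : ∀ {g : ℝ → ℝ}, Measurable g → (∀ y ∈ Ioi (0 : ℝ), |g y| ≤ 1) →
      IntegrableOn (fun y => g y * exp (-y)) (Ioi 0) := by
    intro g hg hb
    refine hexp.mono' (by fun_prop) ?_
    refine (ae_restrict_iff' measurableSet_Ioi).mpr (ae_of_all _ fun y hy => ?_)
    rw [norm_mul, norm_of_nonneg (exp_pos _).le]
    exact mul_le_of_le_one_left (exp_pos _).le (hb y hy)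
  have hinv : ∀ y ∈ Ioi (0 : ℝ), 0 < (1 + t * y)⁻¹ ∧ (1 + t * y)⁻¹ ≤ 1 := by
    intro y hy
    have := mul_pos htpos hy
    exact ⟨inv_pos.mpr (by linarith), inv_le_one_of_one_le₀ (by linarith)⟩
  have i0 : IntegrableOn (fun y => (1 + t * y)⁻¹ * exp (-y)) (Ioi 0) :=
    hdom (by fun_prop) fun y hy => by
      rw [abs_of_pos (hinv y hy).1]; exact (hinv y hy).2
  have i2 : IntegrableOn (fun y => ((1 + t * y)⁻¹) ^ 2 * exp (-y)) (Ioi 0) :=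
    hdom (by fun_prop) fun y hy => by
      rw [abs_of_pos (pow_pos (hinv y hy).1 2)]; exact pow_le_one₀ (hinv y hy).1.le (hinv y hy).2
  have hsplit : ∀ y ∈ Ioi (0 : ℝ), y * exp (-y) / (1 + t * y)
      = t⁻¹ * (exp (-y) - (1 + t * y)⁻¹ * exp (-y)) := by
    intro y hy
    have hne := (hpos y (le_of_lt hy)).ne'
    generalize hD : 1 + t * y = D at hne ⊢
    field_simp
    rw [← hD]
    ring
  have i1 : IntegrableOn (fun y => y * exp (-y) / (1 + t * y)) (Ioi 0) :=
    IntegrableOn.congr_fun (by exact (hexp.sub i0).const_mul t⁻¹)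
      (fun y hy => (hsplit y hy).symm) measurableSet_Ioi
  refine ⟨i1, ?_⟩
  have hparts : ∫ y in Ioi (0 : ℝ), (((1 + t * y)⁻¹) ^ 2 * exp (-y) - y * exp (-y) / (1 + t * y))
      = 0 := by
    rw [integral_Ioi_of_hasDerivAt_of_tendsto' (f := fun y => y * (1 + t * y)⁻¹ * exp (-y)) (m := 0)
      ?_ (by exact i2.sub i1) ?_]
    · simp
    · intro y hy
      have hne := (hpos y hy).ne'
      have h1 : HasDerivAt (fun y : ℝ => 1 + t * y) t y := by
        simpa using ((hasDerivAt_id y).const_mul t).const_add 1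
      have h2 : HasDerivAt (fun y : ℝ => exp (-y)) (-exp (-y)) y := by
        simpa using (hasDerivAt_neg y).exp
      refine (((hasDerivAt_id y).mul (h1.inv hne)).mul h2).congr_deriv ?_
      simp only [id, Pi.mul_apply, Pi.inv_apply]
      field_simp
      ring
    · have h0 : Filter.Tendsto (fun y : ℝ => t⁻¹ * exp (-y)) Filter.atTop (nhds 0) := by
        simpa using (tendsto_exp_neg_atTop_nhds_zero).const_mul t⁻¹
      refine squeeze_zero' ?_ ?_ h0
      · filter_upwards [Filter.eventually_ge_atTop 0] with y hy
        have := hpos y hy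
        positivity
      · filter_upwards [Filter.eventually_ge_atTop 0] with y hy
        have := hpos y hy
        gcongr
        rw [← div_eq_mul_inv, div_le_iff₀ this, ← div_eq_inv_mul, le_div_iff₀ htpos]
        linarith
  rw [integral_sub i2 i1, sub_eq_zero] at hparts
  have hF : t * ∫ y in Ioi (0 : ℝ), y * exp (-y) / (1 + t * y)
      = 1 - ∫ y in Ioi (0 : ℝ), (1 + t * y)⁻¹ * exp (-y) := by
    rw [setIntegral_congr_fun measurableSet_Ioi hsplit, integral_const_mul,
      integral_sub hexp i0, integral_exp_neg_Ioi_zero, mul_inv_cancel_left₀ htpos.ne']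
  have hsq : 0 ≤ ∫ y in Ioi (0 : ℝ), ((1 + t * y)⁻¹ - (1 - r)) ^ 2 * exp (-y) :=
    integral_nonneg fun y => by positivity
  have hexpand : ∫ y in Ioi (0 : ℝ), ((1 + t * y)⁻¹ - (1 - r)) ^ 2 * exp (-y)
      = (∫ y in Ioi (0 : ℝ), ((1 + t * y)⁻¹) ^ 2 * exp (-y))
        - 2 * (1 - r) * (∫ y in Ioi (0 : ℝ), (1 + t * y)⁻¹ * exp (-y)) + (1 - r) ^ 2 := by
    have : (1 - r) ^ 2 = ∫ y in Ioi (0 : ℝ), (1 - r) ^ 2 * exp (-y) := by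
      rw [integral_const_mul, integral_exp_neg_Ioi_zero, mul_one]
    conv_rhs => rw [this]
    rw [← integral_const_mul, ← integral_sub i2 (i0.const_mul _),
      ← integral_add (by exact i2.sub (i0.const_mul _)) (hexp.const_mul _)]
    congr 1; funext y; ring
  rw [hexpand, hparts] at hsq
  set A := ∫ y in Ioi (0 : ℝ), y * exp (-y) / (1 + t * y)
  have hA : ∫ y in Ioi (0 : ℝ), (1 + t * y)⁻¹ * exp (-y) = 1 - t * A := by linarith
  rw [hA] at hsq
  have htr : t * (1 - r) ^ 2 = r := by rw [ht]; field_simp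
  have hfac : 0 ≤ (1 + 2 * t * (1 - r)) * (A - (1 - r) ^ 2) := by
    have : (1 + 2 * t * (1 - r)) * (A - (1 - r) ^ 2)
        = A - 2 * (1 - r) * (1 - t * A) + (1 - r) ^ 2 := by
      linear_combination -2 * (1 - r) * htr
    rw [this]; exact hsq
  have := nonneg_of_mul_nonneg_right hfac (by positivity)
  linarith

lemma exists_eq_div_one_sub_sq {t : ℝ} (ht : 0 < t) : ∃ r, 0 < r ∧ r < 1 ∧ t = r / (1 - r) ^ 2 := by
  set s := √(1 + 4 * t)
  have hs2 : s ^ 2 = 1 + 4 * t := sq_sqrt (by positivity)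
  have hs1 : 1 < s := by
    have : 0 ≤ s := sqrt_nonneg _
    nlinarith
  refine ⟨(s - 1) / (s + 1), div_pos (by linarith) (by linarith),
    (div_lt_one (by linarith)).mpr (by linarith), ?_⟩
  have h1 : 1 - (s - 1) / (s + 1) = 2 / (s + 1) := by field_simp; ring
  rw [h1]
  have h2 : s + 1 ≠ 0 := by positivity
  field_simp
  linarith

lemma IsUniformOnSphere.lintegral_inv_one_add_mul_le {μ : Measure (EuclideanSpace ℝ (Fin 4))}
    [IsProbabilityMeasure μ] (hμ : IsUniformOnSphere μ) {t : ℝ} (ht : 0 < t) :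
    ∫⁻ x, ENNReal.ofReal (1 + t * (2 + 2 * x 0))⁻¹ ∂μ
      ≤ ∫⁻ y in Ioi (0 : ℝ), ENNReal.ofReal (y * exp (-y) / (1 + t * y)) := by
  obtain ⟨r, hr0, hr1, rfl⟩ := exists_eq_div_one_sub_sq ht
  obtain ⟨hi, hle⟩ := sq_le_integral_mul_exp_neg_div hr0 hr1
  have hc : 0 < 1 - r := by linarith
  rw [← ofReal_integral_eq_lintegral_ofReal hi ((ae_restrict_iff' measurableSet_Ioi).mpr
    (ae_of_all _ fun y hy => by
      have : (0 : ℝ) < y := hy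
      positivity))]
  have hG := hμ.integral_inv_one_add_sq hr0 hr1
  have e : ∀ x : EuclideanSpace ℝ (Fin 4), (1 + r / (1 - r) ^ 2 * (2 + 2 * x 0))⁻¹
      = (1 - r) ^ 2 * (1 + r ^ 2 + 2 * r * x 0)⁻¹ := by
    intro x
    rw [show 1 + r ^ 2 + 2 * r * x 0
      = (1 - r) ^ 2 * (1 + r / (1 - r) ^ 2 * (2 + 2 * x 0)) by field_simp; ring, mul_inv,
      mul_inv_cancel_left₀ (by positivity)]
  have hInt : Integrable (fun x : EuclideanSpace ℝ (Fin 4) =>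
      (1 + r ^ 2 + 2 * r * x 0)⁻¹) μ := by
    by_contra hcon
    rw [integral_undef hcon] at hG
    exact zero_ne_one hG
  simp_rw [e]
  rw [← ofReal_integral_eq_lintegral_ofReal (hInt.const_mul _), integral_const_mul, hG, mul_one]
  · exact ENNReal.ofReal_le_ofReal hle
  · filter_upwards [hμ.ae_apply_mem_Icc 0] with x hx
    have : 0 < 1 + r ^ 2 + 2 * r * x 0 := by nlinarith [hx.1, pow_pos hc 2]
    positivity

lemma integrableOn_rpow_div_one_add {a : ℝ} (ha0 : 0 < a) (ha1 : a < 1) :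
    IntegrableOn (fun t : ℝ => t ^ (a - 1) / (1 + t)) (Ioi 0) := by
  rw [← Ioc_union_Ioi_eq_Ioi (zero_le_one' ℝ)]
  refine IntegrableOn.union ?_ ?_
  · have h : IntegrableOn (fun t : ℝ => t ^ (a - 1)) (Ioc 0 1) :=
      (intervalIntegrable_iff_integrableOn_Ioc_of_le zero_le_one).mp
        (intervalIntegral.intervalIntegrable_rpow' (by linarith))
    refine h.mono' (Measurable.aestronglyMeasurable (by fun_prop))
      ((ae_restrict_iff' measurableSet_Ioc).mpr (ae_of_all _ fun t ht => ?_))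
    have h1 : 0 < t := ht.1
    have h2 : 0 < t ^ (a - 1) := rpow_pos_of_pos h1 _
    rw [norm_of_nonneg (by positivity)]
    exact div_le_self h2.le (by linarith)
  · have h : IntegrableOn (fun t : ℝ => t ^ (a - 2)) (Ioi 1) :=
      integrableOn_Ioi_rpow_of_lt (by linarith) one_pos
    refine h.mono' (Measurable.aestronglyMeasurable (by fun_prop))
      ((ae_restrict_iff' measurableSet_Ioi).mpr (ae_of_all _ fun t ht => ?_))
    have h1 : (1 : ℝ) < t := ht
    have h0 : 0 < t := by linarith
    have h2 : 0 < t ^ (a - 2) := rpow_pos_of_pos h0 _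
    have h3 : t ^ (a - 1) = t ^ (a - 2) * t := by
      rw [← rpow_add_one h0.ne']; congr 1; ring
    rw [norm_of_nonneg (by positivity), h3, div_le_iff₀ (by linarith)]
    nlinarith

lemma lintegral_rpow_div_one_add_mul {a w : ℝ} (ha0 : 0 < a) (ha1 : a < 1) (hw : 0 < w) :
    ∫⁻ t in Ioi (0 : ℝ), ENNReal.ofReal (t ^ (a - 1) / (1 + t * w))
      = ENNReal.ofReal (∫ t in Ioi (0 : ℝ), t ^ (a - 1) / (1 + t)) * ENNReal.ofReal (w ^ (-a)) := by
  set g : ℝ → ℝ := fun t => t ^ (a - 1) / (1 + t) with hg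
  have hgi := integrableOn_rpow_div_one_add ha0 ha1
  have e : ∀ t ∈ Ioi (0 : ℝ), w ^ (1 - a) * g (w * t) = t ^ (a - 1) / (1 + t * w) := by
    intro t ht
    have ht' : 0 < t := ht
    simp only [hg]
    rw [mul_rpow hw.le ht'.le, ← mul_div_assoc, ← mul_assoc, ← rpow_add hw]
    simp [mul_comm]
  have hi : IntegrableOn (fun t => t ^ (a - 1) / (1 + t * w)) (Ioi 0) := by
    have h := (integrableOn_Ioi_comp_mul_left_iff g 0 hw).mpr (by rwa [mul_zero])
    exact IntegrableOn.congr_fun (by exact h.const_mul (w ^ (1 - a))) e measurableSet_Ioi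
  have hK : 0 ≤ ∫ t in Ioi (0 : ℝ), g t := setIntegral_nonneg measurableSet_Ioi fun t ht => by
    have : 0 < t := ht
    positivity
  rw [← ofReal_integral_eq_lintegral_ofReal hi ((ae_restrict_iff' measurableSet_Ioi).mpr
    (ae_of_all _ fun t ht => by
      have : 0 < t := ht
      positivity)), ← ENNReal.ofReal_mul hK, ← setIntegral_congr_fun measurableSet_Ioi e,
    integral_const_mul, integral_comp_mul_left_Ioi g 0 hw, mul_zero, smul_eq_mul, ← mul_assoc,
    ← rpow_neg_one w, ← rpow_add hw, mul_comm]
  congr 3; ring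

lemma IsUniformOnSphere.lintegral_two_add_rpow_le {μ : Measure (EuclideanSpace ℝ (Fin 4))}
    [IsProbabilityMeasure μ] (hμ : IsUniformOnSphere μ) {a : ℝ} (ha0 : 0 < a) (ha1 : a ≤ 1) :
    ∫⁻ x, ENNReal.ofReal ((2 + 2 * x 0) ^ (-a)) ∂μ ≤ ENNReal.ofReal (Gamma (2 - a)) := by
  rcases ha1.eq_or_lt with rfl | ha1
  · have : ∫⁻ x, ENNReal.ofReal ((2 + 2 * x 0) ^ (-1 : ℝ)) ∂μ
        = ∫⁻ x, (ENNReal.ofReal (2 + 2 * x 0))⁻¹ ∂μ := by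
      refine lintegral_congr_ae ?_
      filter_upwards [hμ.ae_two_add_pos] with x hx
      rw [rpow_neg_one, ENNReal.ofReal_inv_of_pos hx]
    rw [this, show (2 : ℝ) - 1 = 1 by norm_num, Gamma_one, ENNReal.ofReal_one]
    exact hμ.lintegral_inv_two_add_le
  set K := ∫ t in Ioi (0 : ℝ), t ^ (a - 1) / (1 + t) with hK
  have hKpos : 0 < K := by
    rw [hK, setIntegral_pos_iff_support_of_nonneg_ae ((ae_restrict_iff' measurableSet_Ioi).mpr
      (ae_of_all _ fun t ht => by
        have : (0 : ℝ) < t := ht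
        simp only [Pi.zero_apply]
        positivity)) (integrableOn_rpow_div_one_add ha0 ha1)]
    have : Ioi (0 : ℝ) ⊆ Function.support (fun t : ℝ => t ^ (a - 1) / (1 + t)) ∩ Ioi 0 := by
      intro t ht
      have h : (0 : ℝ) < t := ht
      refine ⟨?_, ht⟩
      rw [Function.mem_support]
      positivity
    exact lt_of_lt_of_le (by simp) (measure_mono this)
  have hK0 : ENNReal.ofReal K ≠ 0 := (ENNReal.ofReal_pos.mpr hKpos).ne'
  rw [← ENNReal.mul_le_mul_iff_right hK0 ENNReal.ofReal_ne_top]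
  calc ENNReal.ofReal K * ∫⁻ x, ENNReal.ofReal ((2 + 2 * x 0) ^ (-a)) ∂μ
      = ∫⁻ x, (∫⁻ t in Ioi (0 : ℝ),
          ENNReal.ofReal (t ^ (a - 1) / (1 + t * (2 + 2 * x 0)))) ∂μ := by
        rw [← lintegral_const_mul _ (by fun_prop)]
        refine lintegral_congr_ae ?_
        filter_upwards [hμ.ae_two_add_pos] with x hx
        rw [lintegral_rpow_div_one_add_mul ha0 ha1 hx]
    _ = ∫⁻ t in Ioi (0 : ℝ), ∫⁻ x, ENNReal.ofReal (t ^ (a - 1) / (1 + t * (2 + 2 * x 0))) ∂μ :=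
        lintegral_lintegral_swap
          (Measurable.aemeasurable (by unfold Function.uncurry; fun_prop))
    _ = ∫⁻ t in Ioi (0 : ℝ), ENNReal.ofReal (t ^ (a - 1)) *
          ∫⁻ x, ENNReal.ofReal (1 + t * (2 + 2 * x 0))⁻¹ ∂μ := by
        refine setLIntegral_congr_fun measurableSet_Ioi fun t ht => ?_
        have : (0 : ℝ) < t := ht
        rw [← lintegral_const_mul _ (by fun_prop)]
        exact lintegral_congr fun x => by
          rw [← ENNReal.ofReal_mul (by positivity), div_eq_mul_inv]
    _ ≤ ∫⁻ t in Ioi (0 : ℝ), ENNReal.ofReal (t ^ (a - 1)) *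
          ∫⁻ y in Ioi (0 : ℝ), ENNReal.ofReal (y * exp (-y) / (1 + t * y)) := by
        refine setLIntegral_mono' measurableSet_Ioi fun t ht => ?_
        gcongr
        exact hμ.lintegral_inv_one_add_mul_le ht
    _ = ∫⁻ t in Ioi (0 : ℝ), ∫⁻ y in Ioi (0 : ℝ),
          ENNReal.ofReal (y * exp (-y)) * ENNReal.ofReal (t ^ (a - 1) / (1 + t * y)) := by
        refine setLIntegral_congr_fun measurableSet_Ioi fun t ht => ?_
        have h : (0 : ℝ) < t := ht
        rw [← lintegral_const_mul _ (by fun_prop)]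
        refine setLIntegral_congr_fun measurableSet_Ioi fun y hy => ?_
        have h' : (0 : ℝ) < y := hy
        rw [← ENNReal.ofReal_mul (by positivity), ← ENNReal.ofReal_mul (by positivity)]
        congr 1; ring
    _ = ∫⁻ y in Ioi (0 : ℝ), ∫⁻ t in Ioi (0 : ℝ),
          ENNReal.ofReal (y * exp (-y)) * ENNReal.ofReal (t ^ (a - 1) / (1 + t * y)) :=
        lintegral_lintegral_swap
          (Measurable.aemeasurable (by unfold Function.uncurry; fun_prop))
    _ = ∫⁻ y in Ioi (0 : ℝ), ENNReal.ofReal K * ENNReal.ofReal (exp (-y) * y ^ (2 - a - 1)) := by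
        refine setLIntegral_congr_fun measurableSet_Ioi fun y hy => ?_
        have h' : (0 : ℝ) < y := hy
        rw [lintegral_const_mul _ (by fun_prop), lintegral_rpow_div_one_add_mul ha0 ha1 h',
          ← ENNReal.ofReal_mul hKpos.le, ← ENNReal.ofReal_mul hKpos.le,
          ← ENNReal.ofReal_mul (by positivity),
          show 2 - a - 1 = 1 + -a by ring, rpow_add h', rpow_one]
        congr 1; ring
    _ = ENNReal.ofReal K * ENNReal.ofReal (Gamma (2 - a)) := by
        rw [lintegral_const_mul _ (by fun_prop), Gamma_eq_integral (by linarith),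
          ofReal_integral_eq_lintegral_ofReal (GammaIntegral_convergent (by linarith))]
        exact (ae_restrict_iff' measurableSet_Ioi).mpr (ae_of_all _ fun y hy => by
          have h' : (0 : ℝ) < y := hy
          simp only [Pi.zero_apply]
          positivity)

lemma sum_antidiagonal_inv_factorial_mul (n : ℕ) :
    ∑ ij ∈ Finset.HasAntidiagonal.antidiagonal n,
        (1 / ((ij.1.factorial : ℝ) * (ij.1 + 1).factorial)) *
        (1 / ((ij.2.factorial : ℝ) * (ij.2 + 1).factorial))
      = ((n + 1).centralBinom : ℝ) / (n + 2) / (n.factorial * (n + 1).factorial) := by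
  have hvand := Nat.add_choose_eq (n + 1) (n + 1) n
  have h1 : ∀ ij ∈ Finset.HasAntidiagonal.antidiagonal n,
      (1 / ((ij.1.factorial : ℝ) * (ij.1 + 1).factorial)) *
        (1 / ((ij.2.factorial : ℝ) * (ij.2 + 1).factorial))
      = (((n + 1).choose ij.1 * (n + 1).choose ij.2 : ℕ) : ℝ) / ((n + 1).factorial : ℝ) ^ 2 := by
    rintro ⟨i, j⟩ hij
    obtain rfl : i + j = n := Finset.HasAntidiagonal.mem_antidiagonal.mp hij
    rw [Nat.cast_mul, Nat.cast_choose ℝ (show i ≤ i + j + 1 by omega),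
      Nat.cast_choose ℝ (show j ≤ i + j + 1 by omega),
      show i + j + 1 - i = j + 1 by omega, show i + j + 1 - j = i + 1 by omega]
    have := fun k : ℕ => (Nat.cast_ne_zero (R := ℝ)).mpr k.factorial_ne_zero
    field_simp [this]
  rw [Finset.sum_congr rfl h1, ← Finset.sum_div, ← Nat.cast_sum, ← hvand]
  have h2 : (n + 1).centralBinom * (n + 1) = (n + 1 + (n + 1)).choose n * (n + 2) := by
    rw [Nat.centralBinom, two_mul, Nat.choose_succ_right_eq]
    congr 1; omega
  have h3 : ((n + 1).centralBinom : ℝ) * (n + 1) = (n + 1 + (n + 1)).choose n * (n + 2) := by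
    exact_mod_cast h2
  rw [Nat.factorial_succ]
  push_cast
  have := (Nat.cast_ne_zero (R := ℝ)).mpr n.factorial_ne_zero
  field_simp
  linarith

lemma summable_norm_jj1_term (t : ℝ) : Summable fun k : ℕ =>
    ‖((-1 : ℝ) ^ k / ((k.factorial : ℝ) * ((k + 1).factorial : ℝ))) * (t / 2) ^ (2 * k)‖ := by
  refine (Real.summable_pow_div_factorial ((t / 2) ^ 2)).of_nonneg_of_le
    (fun _ => norm_nonneg _) fun k => ?_
  have h1 : (1 : ℝ) ≤ (k + 1).factorial := by exact_mod_cast Nat.factorial_pos _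
  have h2 : (0 : ℝ) < k.factorial := by exact_mod_cast Nat.factorial_pos _
  rw [norm_mul, norm_div, norm_pow, norm_neg, norm_one, one_pow, pow_mul,
    norm_of_nonneg (by positivity), norm_of_nonneg (by positivity), one_div_mul_eq_div]
  gcongr
  exact le_mul_of_one_le_right h2.le h1

lemma jj1_sq (t : ℝ) : jj1 t ^ 2 = ∑' k : ℕ, (-1 : ℝ) ^ k *
    (((k + 1).centralBinom : ℝ) / (k + 2) / (k.factorial * (k + 1).factorial)) *
      (t / 2) ^ (2 * k) := by
  rw [pow_two, jj1, tsum_mul_tsum_eq_tsum_sum_antidiagonal_of_summable_norm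
    (summable_norm_jj1_term t) (summable_norm_jj1_term t)]
  refine tsum_congr fun n => ?_
  rw [← sum_antidiagonal_inv_factorial_mul, Finset.mul_sum, Finset.sum_mul]
  refine Finset.sum_congr rfl ?_
  rintro ⟨i, j⟩ hij
  obtain rfl : i + j = n := Finset.HasAntidiagonal.mem_antidiagonal.mp hij
  simp only
  rw [mul_add, pow_add, pow_add]
  ring

lemma measurable_jj1 : Measurable jj1 := by
  refine measurable_of_tendsto_metrizable (f := fun n t => ∑ k ∈ Finset.range n,
    ((-1 : ℝ) ^ k / ((k.factorial : ℝ) * ((k + 1).factorial : ℝ))) * (t / 2) ^ (2 * k))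
    (fun n => by fun_prop) ?_
  rw [tendsto_pi_nhds]
  exact fun t => (summable_norm_jj1_term t).of_norm.hasSum.tendsto_sum_nat

/-- Euler's beta integral over the reals. -/
lemma integral_rpow_mul_one_sub_rpow {α β : ℝ} (hα : 0 < α) (hβ : 0 < β) :
    IntegrableOn (fun u : ℝ => u ^ (α - 1) * (1 - u) ^ (β - 1)) (Ioo 0 1) ∧
    ∫ u in Ioo (0 : ℝ) 1, u ^ (α - 1) * (1 - u) ^ (β - 1)
      = Gamma α * Gamma β / Gamma (α + β) := by
  have hb := ProbabilityTheory.beta_pos hα hβ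
  have h := ProbabilityTheory.lintegral_betaPDF_eq_one hα hβ
  rw [ProbabilityTheory.lintegral_betaPDF] at h
  have hnn : 0 ≤ᵐ[volume.restrict (Ioo (0 : ℝ) 1)]
      fun u => 1 / ProbabilityTheory.beta α β * u ^ (α - 1) * (1 - u) ^ (β - 1) :=
    (ae_restrict_iff' measurableSet_Ioo).mpr (ae_of_all _ fun u hu => by
      have h1 := hu.1
      have h2 : 0 < 1 - u := by linarith [hu.2]
      simp only [Pi.zero_apply]
      positivity)
  have hi : IntegrableOn
      (fun u => 1 / ProbabilityTheory.beta α β * u ^ (α - 1) * (1 - u) ^ (β - 1)) (Ioo 0 1) := by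
    refine ⟨Measurable.aestronglyMeasurable (by fun_prop), ?_⟩
    rw [hasFiniteIntegral_iff_ofReal hnn, h]
    exact ENNReal.one_lt_top
  have e : ∀ u : ℝ, u ^ (α - 1) * (1 - u) ^ (β - 1) = ProbabilityTheory.beta α β *
      (1 / ProbabilityTheory.beta α β * u ^ (α - 1) * (1 - u) ^ (β - 1)) := by
    intro u
    field_simp
  rw [← ofReal_integral_eq_lintegral_ofReal hi hnn, ENNReal.ofReal_eq_one] at h
  simp_rw [e]
  exact ⟨hi.const_mul _, by rw [integral_const_mul, h, mul_one]; rfl⟩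

lemma integrable_tsum_of_summable_integral_norm {α : Type*} [MeasurableSpace α] {ν : Measure α}
    {F : ℕ → α → ℝ} (hF : ∀ k, Integrable (F k) ν) (hs : Summable fun k => ∫ x, ‖F k x‖ ∂ν)
    (hm : AEStronglyMeasurable (fun x => ∑' k, F k x) ν) :
    Integrable (fun x => ∑' k, F k x) ν := by
  refine ⟨hm, lt_of_le_of_lt (lintegral_mono fun x => enorm_tsum_le_tsum_enorm) ?_⟩
  rw [lintegral_tsum fun k => (hF k).1.enorm]
  have e : ∀ k, ∫⁻ x, ‖F k x‖ₑ ∂ν = ENNReal.ofReal (∫ x, ‖F k x‖ ∂ν) := fun k =>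
    (ofReal_integral_norm_eq_lintegral_enorm (hF k)).symm
  simp_rw [e]
  rw [← ENNReal.ofReal_tsum_of_nonneg (fun k => integral_nonneg fun x => norm_nonneg _) hs]
  exact ENNReal.ofReal_lt_top

lemma ofReal_integral_le_lintegral {α : Type*} [MeasurableSpace α] {ν : Measure α}
    {f : α → ℝ} (hf : 0 ≤ᵐ[ν] f) :
    ENNReal.ofReal (∫ x, f x ∂ν) ≤ ∫⁻ x, ENNReal.ofReal (f x) ∂ν := by
  by_cases h : Integrable f ν
  · exact (ofReal_integral_eq_lintegral_ofReal h hf).le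
  · simp [integral_undef h]

lemma centralBinom_succ_div_le (k : ℕ) :
    ((k + 1).centralBinom : ℝ) / (k + 2) ≤ 4 * 4 ^ k := by
  have h : ((k + 1).centralBinom : ℝ) ≤ 4 ^ (k + 1) := by
    exact_mod_cast Nat.centralBinom_le_four_pow (k + 1)
  refine (div_le_self (by positivity) ?_).trans (h.trans_eq (by ring))
  linarith [k.cast_nonneg (α := ℝ)]

/-- The Laplace transform of `2 + 2 x₀ = ‖e₁ + x‖ ^ 2` as a power series. -/
lemma IsUniformOnSphere.integral_exp_neg_mul {μ : Measure (EuclideanSpace ℝ (Fin 4))}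
    [IsProbabilityMeasure μ] (hμ : IsUniformOnSphere μ) (v : ℝ) :
    ∫ x, exp (-v * (2 + 2 * x 0)) ∂μ
      = ∑' k : ℕ, (-v) ^ k / k.factorial * (((k + 1).centralBinom : ℝ) / (k + 2)) := by
  have hi : ∀ k : ℕ, Integrable (fun x : EuclideanSpace ℝ (Fin 4) =>
      (-v) ^ k / k.factorial * (2 + 2 * x 0) ^ k) μ := fun k =>
    (hμ.integrable_comp_apply 0 (F := fun y => (2 + 2 * y) ^ k) (by fun_prop)
      (by fun_prop)).const_mul _
  have hn : ∀ k : ℕ, ∫ x, ‖(-v) ^ k / k.factorial * (2 + 2 * x 0) ^ k‖ ∂μ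
      = |v| ^ k / k.factorial * (((k + 1).centralBinom : ℝ) / (k + 2)) := by
    intro k
    rw [← hμ.integral_two_add_pow k, ← integral_const_mul]
    refine integral_congr_ae ?_
    filter_upwards [hμ.ae_two_add_pos] with x hx
    rw [norm_mul, norm_div, norm_pow, norm_neg, Real.norm_eq_abs, norm_of_nonneg (by positivity),
      norm_of_nonneg (by positivity)]
  have hs : Summable fun k : ℕ => ∫ x, ‖(-v) ^ k / k.factorial * (2 + 2 * x 0) ^ k‖ ∂μ := by
    simp_rw [hn]
    refine ((Real.summable_pow_div_factorial (4 * |v|)).mul_left 4).of_nonneg_of_le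
      (fun _ => by positivity) fun k => ?_
    calc |v| ^ k / k.factorial * (((k + 1).centralBinom : ℝ) / (k + 2))
        ≤ |v| ^ k / k.factorial * (4 * 4 ^ k) := by gcongr; exact centralBinom_succ_div_le k
      _ = _ := by rw [mul_pow]; ring
  have h := integral_tsum_of_summable_integral_norm hi hs
  simp_rw [integral_const_mul, hμ.integral_two_add_pow] at h
  rw [h]
  refine integral_congr_ae (ae_of_all _ fun x => ?_)
  simp only
  rw [Real.exp_eq_exp_ℝ, NormedSpace.exp_eq_tsum_div]
  exact tsum_congr fun k => by rw [mul_pow]; ring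

/-- The Gaussian regularisation of `∫ 𝔧₁(t)² t^{2a-1} dt` as an integral of the Laplace transform
of `2 + 2 x₀`. -/
lemma IsUniformOnSphere.integral_jj1_sq_mul_exp {μ : Measure (EuclideanSpace ℝ (Fin 4))}
    [IsProbabilityMeasure μ] (hμ : IsUniformOnSphere μ) {a ε : ℝ} (ha0 : 0 < a) (ha1 : a ≤ 1)
    (hε : 0 < ε) :
    IntegrableOn (fun t => jj1 t ^ 2 * (t ^ (2 * a - 1) * exp (-ε * t ^ 2))) (Ioi 0) ∧
    ∫ t in Ioi (0 : ℝ), jj1 t ^ 2 * (t ^ (2 * a - 1) * exp (-ε * t ^ 2))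
      = ∫ u in Ioo (0 : ℝ) 1, ε ^ (-a) / (2 * Gamma (2 - a)) *
          (u ^ (a - 1) * (1 - u) ^ (1 - a)) * ∫ x, exp (-(u / (4 * ε)) * (2 + 2 * x 0)) ∂μ := by
  set m : ℕ → ℝ := fun k => ((k + 1).centralBinom : ℝ) / (k + 2) with hm
  set B : ℕ → ℝ := fun k => ∫ u in Ioo (0 : ℝ) 1, u ^ (k + a - 1) * (1 - u) ^ (2 - a - 1) with hB
  set D : ℝ := ε ^ (-a) / (2 * Gamma (2 - a)) with hD
  have hG : 0 < Gamma (2 - a) := Gamma_pos_of_pos (by linarith)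
  have hD0 : 0 < D := by positivity
  have hm0 : ∀ k, 0 ≤ m k := fun k => by positivity
  have hbeta := fun k : ℕ => integral_rpow_mul_one_sub_rpow (α := k + a) (β := 2 - a)
    (by positivity) (by linarith)
  have hB0 : ∀ k, 0 ≤ B k := fun k => setIntegral_nonneg measurableSet_Ioo fun u hu => by
    have h1 := hu.1
    have h2 : 0 < 1 - u := by linarith [hu.2]
    positivity
  have hBle : ∀ k, B k ≤ B 0 := fun k =>
    setIntegral_mono_on (hbeta k).1 (hbeta 0).1 measurableSet_Ioo fun u hu => by
      have h1 := hu.1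
      have h2 : 0 < 1 - u := by linarith [hu.2]
      gcongr ?_ * _
      exact rpow_le_rpow_of_exponent_ge h1 hu.2.le (by simp)
  have hBG : ∀ k : ℕ, Gamma (k + a) * Gamma (2 - a) = B k * (k + 1).factorial := by
    intro k
    rw [hB]
    simp only
    rw [(hbeta k).2, show (k : ℝ) + a + (2 - a) = (k + 1 : ℕ) + 1 by push_cast; ring,
      Gamma_nat_eq_factorial]
    field_simp
  -- the common value of the termwise integrals
  set c : ℕ → ℝ := fun k => D * ((1 / (4 * ε)) ^ k / k.factorial * m k) with hc
  have hc0 : ∀ k, 0 ≤ c k := fun k => by have := hm0 k; positivity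
  have hsum : Summable fun k => c k * B k := by
    refine ((Real.summable_pow_div_factorial (1 / ε)).mul_left (4 * D * B 0)).of_nonneg_of_le
      (fun k => mul_nonneg (hc0 k) (hB0 k)) fun k => ?_
    calc c k * B k ≤ D * ((1 / (4 * ε)) ^ k / k.factorial * (4 * 4 ^ k)) * B 0 := by
          have h4 := centralBinom_succ_div_le k
          have := hB0 k
          have := hBle k
          simp only [hc]
          gcongr
      _ = _ := by
          rw [show 1 / (4 * ε) = 1 / ε / 4 by field_simp, div_pow]
          field_simp
  -- expansion in `t`
  set F : ℕ → ℝ → ℝ := fun k t => (-1 : ℝ) ^ k * (m k / (k.factorial * (k + 1).factorial)) *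
      (t / 2) ^ (2 * k) * (t ^ (2 * a - 1) * exp (-ε * t ^ 2)) with hF
  have hFe : ∀ k, ∀ t ∈ Ioi (0 : ℝ), (-1 : ℝ) ^ k *
      (m k / (k.factorial * (k + 1).factorial) / 4 ^ k) *
        (t ^ (2 * k + 2 * a - 1) * exp (-ε * t ^ (2 : ℝ))) = F k t := by
    intro k t ht
    have h : (0 : ℝ) < t := ht
    simp only [hF]
    rw [show (2 : ℝ) * k + 2 * a - 1 = (2 * k : ℕ) + (2 * a - 1) by push_cast; ring, rpow_add h,
      rpow_natCast, rpow_two, div_pow, pow_mul 2]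
    norm_num
    ring
  have hFe' : ∀ k, ∀ t ∈ Ioi (0 : ℝ),
      (m k / (k.factorial * (k + 1).factorial) / 4 ^ k) *
        (t ^ (2 * k + 2 * a - 1) * exp (-ε * t ^ (2 : ℝ))) = ‖F k t‖ := by
    intro k t ht
    have h : (0 : ℝ) < t := ht
    have := hm0 k
    rw [← hFe k t ht, mul_assoc, norm_mul, norm_pow, norm_neg, norm_one, one_pow, one_mul,
      norm_of_nonneg (by positivity)]
  have hFi : ∀ k, IntegrableOn (F k) (Ioi 0) := fun k =>
    IntegrableOn.congr_fun (by
      exact (integrableOn_rpow_mul_exp_neg_mul_rpow (s := 2 * k + 2 * a - 1) (p := 2)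
        (by linarith [k.cast_nonneg (α := ℝ)]) (by norm_num) hε).const_mul _)
      (hFe k) measurableSet_Ioi
  have hval : ∀ k : ℕ, (m k / (k.factorial * (k + 1).factorial) / 4 ^ k) *
      ∫ t in Ioi (0 : ℝ), t ^ (2 * k + 2 * a - 1) * exp (-ε * t ^ (2 : ℝ)) = c k * B k := by
    intro k
    rw [integral_rpow_mul_exp_neg_mul_rpow (by norm_num)
      (by linarith [k.cast_nonneg (α := ℝ)]) hε,
      show (2 * (k : ℝ) + 2 * a - 1 + 1) / 2 = k + a by ring,
      show -(2 * (k : ℝ) + 2 * a - 1 + 1) / 2 = -a - k by ring,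
      show Gamma (k + a) = B k * (k + 1).factorial / Gamma (2 - a) by
        rw [← hBG]; field_simp, rpow_sub hε, rpow_natCast]
    simp only [hc, hD, div_pow, mul_pow, one_pow]
    have := (Nat.cast_ne_zero (R := ℝ)).mpr (k + 1).factorial_ne_zero
    field_simp
  have hFint : ∀ k, ∫ t in Ioi (0 : ℝ), F k t = (-1) ^ k * (c k * B k) := by
    intro k
    rw [← hval, ← setIntegral_congr_fun measurableSet_Ioi (hFe k), integral_const_mul, mul_assoc]
  have hFs : Summable fun k => ∫ t in Ioi (0 : ℝ), ‖F k t‖ := by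
    refine hsum.congr fun k => ?_
    rw [← hval, ← setIntegral_congr_fun measurableSet_Ioi (hFe' k), integral_const_mul]
  have hFtsum : ∀ t, ∑' k, F k t = jj1 t ^ 2 * (t ^ (2 * a - 1) * exp (-ε * t ^ 2)) := by
    intro t
    rw [jj1_sq, ← tsum_mul_right]
  have hFI := integrable_tsum_of_summable_integral_norm hFi hFs (by
    simp_rw [hFtsum]
    have := measurable_jj1
    exact Measurable.aestronglyMeasurable (by fun_prop))
  have hFt := integral_tsum_of_summable_integral_norm hFi hFs
  simp_rw [hFtsum] at hFI hFt
  refine ⟨hFI, ?_⟩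
  rw [← hFt]
  simp_rw [hFint]
  -- expansion in `u`
  set G : ℕ → ℝ → ℝ := fun k u =>
    (-1) ^ k * c k * (u ^ (k + a - 1) * (1 - u) ^ (2 - a - 1)) with hGdef
  have hGi : ∀ k, IntegrableOn (G k) (Ioo 0 1) := fun k => (hbeta k).1.const_mul _
  have hGn : ∀ k, ∫ u in Ioo (0 : ℝ) 1, ‖G k u‖ = c k * B k := by
    intro k
    rw [hB, ← integral_const_mul]
    refine setIntegral_congr_fun measurableSet_Ioo fun u hu => ?_
    have h1 := hu.1
    have h2 : 0 < 1 - u := by linarith [hu.2]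
    have := hc0 k
    simp only [hGdef]
    rw [mul_assoc, norm_mul, norm_pow, norm_neg, norm_one, one_pow, one_mul,
      norm_of_nonneg (by positivity)]
  have hGt := integral_tsum_of_summable_integral_norm hGi (by simpa only [hGn] using hsum)
  have hGint : ∀ k, ∫ u in Ioo (0 : ℝ) 1, G k u = (-1) ^ k * (c k * B k) := by
    intro k
    rw [hGdef, hB]
    simp only
    rw [integral_const_mul, mul_assoc]
  simp_rw [hGint] at hGt
  rw [hGt]
  refine setIntegral_congr_fun measurableSet_Ioo fun u hu => ?_
  have h1 := hu.1
  rw [hμ.integral_exp_neg_mul, ← tsum_mul_left]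
  refine tsum_congr fun k => ?_
  simp only [hGdef, hc, hm]
  rw [show (k : ℝ) + a - 1 = (a - 1) + k by ring, rpow_add h1, rpow_natCast,
    show 2 - a - 1 = 1 - a by ring, show -(u / (4 * ε)) = (-1) * (u * (1 / (4 * ε))) by ring,
    mul_pow, mul_pow]
  ring

lemma IsUniformOnSphere.lintegral_jj1_sq_mul_exp_le {μ : Measure (EuclideanSpace ℝ (Fin 4))}
    [IsProbabilityMeasure μ] (hμ : IsUniformOnSphere μ) {a ε : ℝ} (ha0 : 0 < a) (ha1 : a ≤ 1)
    (hε : 0 < ε) :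
    ∫⁻ t in Ioi (0 : ℝ), ENNReal.ofReal (jj1 t ^ 2 * (t ^ (2 * a - 1) * exp (-ε * t ^ 2)))
      ≤ ENNReal.ofReal (2 ^ (2 * a - 1) * Gamma a) := by
  obtain ⟨hi, heq⟩ := hμ.integral_jj1_sq_mul_exp ha0 ha1 hε
  have hG : 0 < Gamma (2 - a) := Gamma_pos_of_pos (by linarith)
  have hGa : 0 < Gamma a := Gamma_pos_of_pos ha0
  set D : ℝ := ε ^ (-a) / (2 * Gamma (2 - a)) with hD
  have hD0 : 0 < D := by positivity
  have hΦ : ∀ u : ℝ, Integrable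
      (fun x : EuclideanSpace ℝ (Fin 4) => exp (-(u / (4 * ε)) * (2 + 2 * x 0))) μ := fun u =>
    hμ.integrable_comp_apply 0 (F := fun y => exp (-(u / (4 * ε)) * (2 + 2 * y)))
      (by fun_prop) (by fun_prop)
  rw [← ofReal_integral_eq_lintegral_ofReal hi ((ae_restrict_iff' measurableSet_Ioi).mpr
    (ae_of_all _ fun t ht => by
      have h : (0 : ℝ) < t := ht
      simp only [Pi.zero_apply]
      positivity)), heq]
  refine (ofReal_integral_le_lintegral ((ae_restrict_iff' measurableSet_Ioo).mpr
    (ae_of_all _ fun u hu => by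
      have h1 := hu.1
      have h2 : 0 < 1 - u := by linarith [hu.2]
      have : 0 ≤ ∫ x, exp (-(u / (4 * ε)) * (2 + 2 * x 0)) ∂μ :=
        integral_nonneg fun x => (exp_pos _).le
      simp only [Pi.zero_apply]
      positivity))).trans ?_
  calc ∫⁻ u in Ioo (0 : ℝ) 1, ENNReal.ofReal (D * (u ^ (a - 1) * (1 - u) ^ (1 - a)) *
          ∫ x, exp (-(u / (4 * ε)) * (2 + 2 * x 0)) ∂μ)
      ≤ ∫⁻ u in Ioo (0 : ℝ) 1, (∫⁻ x, ENNReal.ofReal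
          (D * u ^ (a - 1) * exp (-(u / (4 * ε)) * (2 + 2 * x 0))) ∂μ) := by
        refine setLIntegral_mono' measurableSet_Ioo fun u hu => ?_
        have h1 := hu.1
        have h2 : 0 < 1 - u := by linarith [hu.2]
        rw [← ofReal_integral_eq_lintegral_ofReal ((hΦ u).const_mul _)
          (ae_of_all _ fun x => by simp only [Pi.zero_apply]; positivity), integral_const_mul]
        refine ENNReal.ofReal_le_ofReal ?_
        have : 0 ≤ ∫ x, exp (-(u / (4 * ε)) * (2 + 2 * x 0)) ∂μ :=
          integral_nonneg fun x => (exp_pos _).le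
        gcongr
        exact mul_le_of_le_one_right (by positivity)
          (rpow_le_one h2.le (by linarith) (by linarith))
    _ ≤ ∫⁻ u in Ioi (0 : ℝ), (∫⁻ x, ENNReal.ofReal
          (D * u ^ (a - 1) * exp (-(u / (4 * ε)) * (2 + 2 * x 0))) ∂μ) :=
        lintegral_mono_set Ioo_subset_Ioi_self
    _ = ∫⁻ x, (∫⁻ u in Ioi (0 : ℝ), ENNReal.ofReal
          (D * u ^ (a - 1) * exp (-(u / (4 * ε)) * (2 + 2 * x 0)))) ∂μ :=
        lintegral_lintegral_swap
          (Measurable.aemeasurable (by unfold Function.uncurry; fun_prop))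
    _ = ∫⁻ x, ENNReal.ofReal (D * ((4 * ε) ^ a * Gamma a)) *
          ENNReal.ofReal ((2 + 2 * x 0) ^ (-a)) ∂μ := by
        refine lintegral_congr_ae ?_
        filter_upwards [hμ.ae_two_add_pos] with x hx
        set w := 2 + 2 * x 0
        have hr : 0 < w / (4 * ε) := by positivity
        have e : ∀ u : ℝ, D * u ^ (a - 1) * exp (-(u / (4 * ε)) * w)
            = D * (u ^ (a - 1) * exp (-(w / (4 * ε) * u))) := by
          intro u
          rw [mul_assoc]
          congr 3
          ring
        have hInt := integral_rpow_mul_exp_neg_mul_Ioi ha0 hr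
        have hI : IntegrableOn (fun u : ℝ => u ^ (a - 1) * exp (-(w / (4 * ε) * u))) (Ioi 0) := by
          by_contra hcon
          rw [integral_undef hcon] at hInt
          have : 0 < (1 / (w / (4 * ε))) ^ a * Gamma a := by positivity
          linarith
        simp_rw [e]
        rw [← ofReal_integral_eq_lintegral_ofReal (hI.const_mul _)
          ((ae_restrict_iff' measurableSet_Ioi).mpr (ae_of_all _ fun u hu => by
            have h : (0 : ℝ) < u := hu
            simp only [Pi.zero_apply]
            positivity)), integral_const_mul, hInt, ← ENNReal.ofReal_mul (by positivity),
          one_div_div, div_rpow (by positivity) hx.le, rpow_neg hx.le]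
        congr 1
        ring
    _ ≤ ENNReal.ofReal (D * ((4 * ε) ^ a * Gamma a)) * ENNReal.ofReal (Gamma (2 - a)) := by
        rw [lintegral_const_mul _ (by fun_prop)]
        gcongr
        exact hμ.lintegral_two_add_rpow_le ha0 ha1
    _ = ENNReal.ofReal (2 ^ (2 * a - 1) * Gamma a) := by
        rw [← ENNReal.ofReal_mul (by positivity)]
        congr 1
        rw [hD, mul_rpow (by norm_num) hε.le, rpow_neg hε.le, rpow_sub_one (by norm_num),
          rpow_mul (by norm_num), rpow_two]
        have : ε ^ a ≠ 0 := (rpow_pos_of_pos hε a).ne'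
        norm_num
        field_simp

lemma IsUniformOnSphere.lintegral_jj1_sq_le {μ : Measure (EuclideanSpace ℝ (Fin 4))}
    [IsProbabilityMeasure μ] (hμ : IsUniformOnSphere μ) {a : ℝ} (ha0 : 0 < a) (ha1 : a ≤ 1) :
    ∫⁻ t in Ioi (0 : ℝ), ENNReal.ofReal (jj1 t ^ 2 * t ^ (2 * a - 1))
      ≤ ENNReal.ofReal (2 ^ (2 * a - 1) * Gamma a) := by
  have hj := measurable_jj1
  have hfatou := lintegral_liminf_le (μ := volume.restrict (Ioi (0 : ℝ))) (u := Filter.atTop)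
    (f := fun (n : ℕ) (t : ℝ) => ENNReal.ofReal
      (jj1 t ^ 2 * (t ^ (2 * a - 1) * exp (-(1 / ((n : ℝ) + 1)) * t ^ 2))))
    (fun n => by fun_prop)
  have hle := hfatou.trans (Filter.liminf_le_of_le (by isBoundedDefault) fun b hb => by
    obtain ⟨n, hn⟩ := hb.exists
    exact hn.trans (hμ.lintegral_jj1_sq_mul_exp_le ha0 ha1 (by positivity)))
  refine le_trans (le_of_eq (lintegral_congr fun t => ?_)) hle
  refine (Filter.Tendsto.liminf_eq (ENNReal.tendsto_ofReal ?_)).symm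
  have h := (((((tendsto_one_div_add_atTop_nhds_zero_nat (𝕜 := ℝ)).neg.mul_const
    (t ^ 2)).rexp).const_mul (t ^ (2 * a - 1))).const_mul (jj1 t ^ 2))
  simpa using h

lemma IsUniformOnSphere.ae_enorm_single_add_rpow {μ : Measure (EuclideanSpace ℝ (Fin 4))}
    [IsProbabilityMeasure μ] (hμ : IsUniformOnSphere μ) (p : ℝ) :
    ∀ᵐ x ∂μ, (‖EuclideanSpace.single (0 : Fin 4) (1 : ℝ) + x‖₊ : ℝ≥0∞) ^ (-p)
      = ENNReal.ofReal ((2 + 2 * x 0) ^ (-(p / 2))) := by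
  filter_upwards [hμ.ae_two_add_pos, hμ.ae_norm_eq_one] with x hx hx1
  have hsq : ‖EuclideanSpace.single (0 : Fin 4) (1 : ℝ) + x‖ ^ 2 = 2 + 2 * x 0 := by
    rw [norm_add_sq_real, hx1, show ‖EuclideanSpace.single (0 : Fin 4) (1 : ℝ)‖ = 1 by simp,
      EuclideanSpace.inner_single_left]
    norm_num
    ring
  have hpos : 0 < ‖EuclideanSpace.single (0 : Fin 4) (1 : ℝ) + x‖ := by
    refine (norm_nonneg _).lt_of_ne fun h => ?_
    rw [← h] at hsq
    norm_num at hsq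
    linarith
  rw [← hsq, ← rpow_natCast, ← rpow_mul hpos.le,
    show ((2 : ℕ) : ℝ) * -(p / 2) = -p by push_cast; ring, ← ENNReal.ofReal_rpow_of_pos hpos,
    ofReal_norm]
  rfl

/-- For `0 < p ≤ 2`: `∫_0^∞ 𝔧₁(t)² t^{p-1} dt ≤ 2^{p-1} Γ(p/2)`; equivalently,
for `ξ` uniform on the unit sphere `S³` in `ℝ⁴`, `E|e₁ + ξ|^{-p} ≤ Γ(2 - p/2)`. -/
theorem jj1_squared_integral_bound
    (p : ℝ) (hp0 : 0 < p) (hp2 : p ≤ 2)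
    (μ : Measure (EuclideanSpace ℝ (Fin 4))) [IsProbabilityMeasure μ]
    (hμ : IsUniformOnSphere μ) :
    (∫⁻ t in Set.Ioi (0 : ℝ), ENNReal.ofReal ((jj1 t) ^ 2 * t ^ (p - 1))
        ≤ ENNReal.ofReal ((2 : ℝ) ^ (p - 1) * Real.Gamma (p / 2)))
    ∧ (∫⁻ x, (‖EuclideanSpace.single (0 : Fin 4) (1 : ℝ) + x‖₊ : ℝ≥0∞) ^ (-p) ∂μ
        ≤ ENNReal.ofReal (Real.Gamma (2 - p / 2))) := by
  have ha0 : 0 < p / 2 := by linarith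
  have ha1 : p / 2 ≤ 1 := by linarith
  constructor
  · have h := hμ.lintegral_jj1_sq_le ha0 ha1
    rwa [mul_div_cancel₀ p two_ne_zero] at h
  · rw [lintegral_congr_ae (hμ.ae_enorm_single_add_rpow p)]
    exact hμ.lintegral_two_add_rpow_le ha0 ha1
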